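/- For every m' ∈ ℕ, all coefficients α_1,…,α_{m'} ∈ ℝ, points x_1,…,x_{m'} ∈ ℝ^s, and indices k_1,…,k_{m'} ∈ {1,…,t}, one has sup{ |Σ_{j=1}^{m'} α_j f_μ^{k_j}(x_j)| : f_μ ∈ B_N, ‖f_μ‖_{B_N} ≤ 1 } = ‖Σ_{j=1}^{m'} α_j N_{k_j}(x_j,·)ρ(·)‖_∞. In other words, the linear map sending Σ_j α_j δ_{x_j,k_j} (a linear combination of componentwise point evaluation functionals on B_N) to Σ_j α_j N_{k_j}(x_j,·)ρ(·) ∈ C₀(Θ) is an isometric isomorphism between the span of the point evaluation functionals (with the dual norm of B_N) and the span of {N_k(x,·)ρ(·) : x ∈ ℝ^s, k ∈ {1,…,t}} (with the supremum norm). -/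

import Mathlib

open MeasureTheory Filter Topology
open scoped ZeroAtInfty BigOperators

noncomputable section

/-- The parameter space of a depth-`D` deep neural network with layer widths
`m 0, m 1, …, m D` (input dimension `m 0 = s`, output dimension `m D = t`). -/
abbrev Params (m : ℕ → ℕ) (D : ℕ) : Type :=
  (j : Fin D) → ((Fin (m (j.1 + 1)) → Fin (m j.1) → ℝ) × (Fin (m (j.1 + 1)) → ℝ))

/-- The deep neural network `N(x, θ)` of depth `D`, defined recursively by
`N¹(x) = W₁ x + b₁` and `N^{j+1}(x) = W_{j+1} σ(N^j(x)) + b_{j+1}`. -/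
def NNet (σ : ℝ → ℝ) (m : ℕ → ℕ) :
    (D : ℕ) → Params m D → (Fin (m 0) → ℝ) → Fin (m D) → ℝ
  | 0, _, x => x
  | 1, θ, x => fun i => (∑ k, (θ ⟨0, Nat.one_pos⟩).1 i k * x k) + (θ ⟨0, Nat.one_pos⟩).2 i
  | (D + 2), θ, x => fun i =>
      (∑ k, (θ (Fin.last (D + 1))).1 i k *
          σ (NNet σ m (D + 1) (fun j => θ j.castSucc) x k))
        + (θ (Fin.last (D + 1))).2 i

/-- The integral of a function against a finite signed (Radon) measure,
via the Jordan decomposition. -/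
def sInt {Θ : Type*} [MeasurableSpace Θ] (μ : SignedMeasure Θ) (f : Θ → ℝ) : ℝ :=
  (∫ θ, f θ ∂μ.toJordanDecomposition.posPart) - ∫ θ, f θ ∂μ.toJordanDecomposition.negPart

/-- The total variation norm of a signed measure. -/
def tvNorm {Θ : Type*} [MeasurableSpace Θ] (μ : SignedMeasure Θ) : ℝ :=
  (μ.totalVariation Set.univ).toReal

/-- `f_μ^k(x) := ∫_Θ N_k(x,θ) ρ(θ) dμ(θ)`. -/
def fMu (σ : ℝ → ℝ) (m : ℕ → ℕ) (D : ℕ) (ρ : Params m D → ℝ)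
    (μ : SignedMeasure (Params m D)) : (Fin (m 0) → ℝ) → Fin (m D) → ℝ :=
  fun x k => sInt μ fun θ => NNet σ m D θ x k * ρ θ

/-- The set `B_N = {f_μ : μ ∈ M(Θ)}`. -/
def BNset (σ : ℝ → ℝ) (m : ℕ → ℕ) (D : ℕ) (ρ : Params m D → ℝ) :
    Set ((Fin (m 0) → ℝ) → Fin (m D) → ℝ) :=
  {f | ∃ μ : SignedMeasure (Params m D), fMu σ m D ρ μ = f}

/-- The norm `‖f‖_{B_N} = inf {‖ν‖_TV : f_ν = f}`. -/
def BNnorm (σ : ℝ → ℝ) (m : ℕ → ℕ) (D : ℕ) (ρ : Params m D → ℝ)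
    (f : (Fin (m 0) → ℝ) → Fin (m D) → ℝ) : ℝ :=
  sInf (tvNorm '' {ν : SignedMeasure (Params m D) | fMu σ m D ρ ν = f})

/-- `S`: the closed linear span in `C₀(Θ)` of the functions `θ ↦ N_k(x,θ)ρ(θ)`
(given here as the bundled family `Kb`). -/
def Sspan (m : ℕ → ℕ) (D : ℕ)
    (Kb : (Fin (m 0) → ℝ) → Fin (m D) → C₀(Params m D, ℝ)) :
    Submodule ℝ C₀(Params m D, ℝ) :=
  (Submodule.span ℝ
    (Set.range fun p : (Fin (m 0) → ℝ) × Fin (m D) => Kb p.1 p.2)).topologicalClosure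

/-- `V_N := span {K_k(x_j, ·) : j, k}`. -/
def VN (m : ℕ → ℕ) (D : ℕ)
    (Kb : (Fin (m 0) → ℝ) → Fin (m D) → C₀(Params m D, ℝ))
    (M : ℕ) (x : Fin M → (Fin (m 0) → ℝ)) : Submodule ℝ C₀(Params m D, ℝ) :=
  Submodule.span ℝ (Set.range fun p : Fin (m D) × Fin M => Kb (x p.2) p.1)

/-- The interpolation condition `f(x_j) = y_j`, i.e. `f_k(x_j) = y_j^k` for all `j, k`. -/
def interpolates (m : ℕ → ℕ) (D : ℕ) (M : ℕ) (x : Fin M → (Fin (m 0) → ℝ))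
    (Y : Fin (m D) → Fin M → ℝ) (f : (Fin (m 0) → ℝ) → Fin (m D) → ℝ) : Prop :=
  ∀ (j : Fin M) (k : Fin (m D)), f (x j) k = Y k j

/-- The solution set `S_{X,Y}` of the MNI problem
`inf {‖f‖_{B_N} : f ∈ B_N, f(x_j) = y_j}`. -/
def MNISolSet (σ : ℝ → ℝ) (m : ℕ → ℕ) (D : ℕ) (ρ : Params m D → ℝ)
    (M : ℕ) (x : Fin M → (Fin (m 0) → ℝ)) (Y : Fin (m D) → Fin M → ℝ) :
    Set ((Fin (m 0) → ℝ) → Fin (m D) → ℝ) :=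
  {f | f ∈ BNset σ m D ρ ∧ interpolates m D M x Y f ∧
    ∀ μ : SignedMeasure (Params m D), interpolates m D M x Y (fMu σ m D ρ μ) →
      BNnorm σ m D ρ f ≤ BNnorm σ m D ρ (fMu σ m D ρ μ)}

/-- The solution set of the measure MNI problem
`inf {‖μ‖_TV : μ ∈ M(Θ), ∫ K_k(x_j,·) dμ = y_j^k}`. -/
def MeasSolSet (σ : ℝ → ℝ) (m : ℕ → ℕ) (D : ℕ) (ρ : Params m D → ℝ)
    (M : ℕ) (x : Fin M → (Fin (m 0) → ℝ)) (Y : Fin (m D) → Fin M → ℝ) :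
    Set (SignedMeasure (Params m D)) :=
  {μ | interpolates m D M x Y (fMu σ m D ρ μ) ∧
    ∀ ν : SignedMeasure (Params m D), interpolates m D M x Y (fMu σ m D ρ ν) →
      tvNorm μ ≤ tvNorm ν}

/-- The subdifferential `∂‖·‖_∞(g) ⊆ B_N` of the supremum norm at `g ∈ S`, viewing `B_N`
as the dual of `S` via the (representation independent) pairing `⟨f_μ, g⟩ = ∫ g dμ`:
`∂‖·‖_∞(g) = {f_μ ∈ B_N : ‖f_μ‖_{B_N} = 1, ∫ g dμ = ‖g‖_∞}`. -/
def subdiffSup (σ : ℝ → ℝ) (m : ℕ → ℕ) (D : ℕ) (ρ : Params m D → ℝ)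
    (g : C₀(Params m D, ℝ)) : Set ((Fin (m 0) → ℝ) → Fin (m D) → ℝ) :=
  {f | f ∈ BNset σ m D ρ ∧ BNnorm σ m D ρ f = 1 ∧
    ∀ μ : SignedMeasure (Params m D), fMu σ m D ρ μ = f → sInt μ (fun θ => g θ) = ‖g‖}

/-- Feasibility for the dual problem: `‖∑_{k,j} c_{kj} K_k(x_j,·)‖_∞ = 1`. -/
def dualFeasible (m : ℕ → ℕ) (D : ℕ)
    (Kb : (Fin (m 0) → ℝ) → Fin (m D) → C₀(Params m D, ℝ))
    (M : ℕ) (x : Fin M → (Fin (m 0) → ℝ)) (c : Fin (m D) → Fin M → ℝ) : Prop :=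
  ‖∑ k, ∑ j, c k j • Kb (x j) k‖ = 1

/-- The objective `∑_{k,j} c_{kj} y_j^k` of the dual problem. -/
def dualObjective (m : ℕ → ℕ) (D : ℕ) (M : ℕ) (Y : Fin (m D) → Fin M → ℝ)
    (c : Fin (m D) → Fin M → ℝ) : ℝ :=
  ∑ k, ∑ j, c k j * Y k j

/-- `c` is a solution of the dual problem. -/
def dualSolves (m : ℕ → ℕ) (D : ℕ)
    (Kb : (Fin (m 0) → ℝ) → Fin (m D) → C₀(Params m D, ℝ))
    (M : ℕ) (x : Fin M → (Fin (m 0) → ℝ)) (Y : Fin (m D) → Fin M → ℝ)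
    (c : Fin (m D) → Fin M → ℝ) : Prop :=
  dualFeasible m D Kb M x c ∧
    ∀ c' : Fin (m D) → Fin M → ℝ, dualFeasible m D Kb M x c' →
      dualObjective m D M Y c' ≤ dualObjective m D M Y c

/-- `ĝ := C* · ∑_{k,j} ĉ_{kj} K_k(x_j,·)`, where `C*` is the optimal dual value
(the value of the dual objective at the dual solution `c`). -/
def ghat (m : ℕ → ℕ) (D : ℕ)
    (Kb : (Fin (m 0) → ℝ) → Fin (m D) → C₀(Params m D, ℝ))
    (M : ℕ) (x : Fin M → (Fin (m 0) → ℝ)) (Y : Fin (m D) → Fin M → ℝ)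
    (c : Fin (m D) → Fin M → ℝ) : C₀(Params m D, ℝ) :=
  dualObjective m D M Y c • ∑ k, ∑ j, c k j • Kb (x j) k

/-- `Θ(g) := {θ ∈ Θ : |g(θ)| = ‖g‖_∞}`. -/
def ThetaSet (m : ℕ → ℕ) (D : ℕ) (g : C₀(Params m D, ℝ)) : Set (Params m D) :=
  {θ | |g θ| = ‖g‖}

/-- The regularization objective `Q(I_X(f) − Y) + λ ‖f‖_{B_N}`. -/
def regObj (σ : ℝ → ℝ) (m : ℕ → ℕ) (D : ℕ) (ρ : Params m D → ℝ)
    (M : ℕ) (x : Fin M → (Fin (m 0) → ℝ)) (Y : Fin (m D) → Fin M → ℝ)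
    (lam : ℝ) (Q : (Fin (m D) → Fin M → ℝ) → ℝ)
    (f : (Fin (m 0) → ℝ) → Fin (m D) → ℝ) : ℝ :=
  Q ((fun k j => f (x j) k) - Y) + lam * BNnorm σ m D ρ f

/-- The solution set `R_{X,Y}` of the regularization problem. -/
def RegSolSet (σ : ℝ → ℝ) (m : ℕ → ℕ) (D : ℕ) (ρ : Params m D → ℝ)
    (M : ℕ) (x : Fin M → (Fin (m 0) → ℝ)) (Y : Fin (m D) → Fin M → ℝ)
    (lam : ℝ) (Q : (Fin (m D) → Fin M → ℝ) → ℝ) :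
    Set ((Fin (m 0) → ℝ) → Fin (m D) → ℝ) :=
  {f | f ∈ BNset σ m D ρ ∧
    ∀ μ : SignedMeasure (Params m D),
      regObj σ m D ρ M x Y lam Q f ≤ regObj σ m D ρ M x Y lam Q (fMu σ m D ρ μ)}

/-- `D_{X,Y} := I_X(R_{X,Y})`. -/
def DXY (σ : ℝ → ℝ) (m : ℕ → ℕ) (D : ℕ) (ρ : Params m D → ℝ)
    (M : ℕ) (x : Fin M → (Fin (m 0) → ℝ)) (Y : Fin (m D) → Fin M → ℝ)
    (lam : ℝ) (Q : (Fin (m D) → Fin M → ℝ) → ℝ) : Set (Fin (m D) → Fin M → ℝ) :=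
  (fun f => fun k j => f (x j) k) '' RegSolSet σ m D ρ M x Y lam Q



section SignedIntegral

variable {Θ : Type*} [MeasurableSpace Θ]

lemma tvNorm_nonneg (μ : SignedMeasure Θ) : 0 ≤ tvNorm μ := ENNReal.toReal_nonneg

lemma tvNorm_eq_add (μ : SignedMeasure Θ) :
    tvNorm μ = μ.toJordanDecomposition.posPart.real Set.univ +
      μ.toJordanDecomposition.negPart.real Set.univ := by
  unfold tvNorm SignedMeasure.totalVariation
  rw [Measure.add_apply, ENNReal.toReal_add (measure_ne_top _ _) (measure_ne_top _ _)]
  rfl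

lemma abs_sInt_le (μ : SignedMeasure Θ) {f : Θ → ℝ} {C : ℝ} (hf : ∀ θ, |f θ| ≤ C) :
    |sInt μ f| ≤ C * tvNorm μ := by
  have bound (ν : Measure Θ) [IsFiniteMeasure ν] : |∫ θ, f θ ∂ν| ≤ C * ν.real Set.univ := by
    rw [← Real.norm_eq_abs]
    exact norm_integral_le_of_norm_le_const (Eventually.of_forall hf)
  rw [tvNorm_eq_add, mul_add]
  exact (abs_sub _ _).trans (add_le_add (bound _) (bound _))

lemma sum_mul_sInt {ι : Type*} [Fintype ι] (μ : SignedMeasure Θ) (α : ι → ℝ) (f : ι → Θ → ℝ)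
    (hf : ∀ (ν : Measure Θ) [IsFiniteMeasure ν] (j : ι), Integrable (f j) ν) :
    ∑ j, α j * sInt μ (f j) = sInt μ fun θ => ∑ j, α j * f j θ := by
  unfold sInt
  rw [integral_finsetSum _ fun j _ => (hf _ j).const_mul _,
    integral_finsetSum _ fun j _ => (hf _ j).const_mul _]
  simp only [mul_sub, Finset.sum_sub_distrib, integral_const_mul]

/-- The point mass at `θ` as a signed measure. -/
def signedDirac (θ : Θ) : SignedMeasure Θ :=
  JordanDecomposition.toSignedMeasure
    { posPart := Measure.dirac θ
      negPart := 0
      mutuallySingular := Measure.MutuallySingular.zero_right }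

lemma tvNorm_signedDirac (θ : Θ) : tvNorm (signedDirac θ) = 1 := by
  rw [tvNorm_eq_add, signedDirac, JordanDecomposition.toJordanDecomposition_toSignedMeasure]
  simp

lemma sInt_signedDirac (θ : Θ) {f : Θ → ℝ} (hf : StronglyMeasurable f) :
    sInt (signedDirac θ) f = f θ := by
  rw [sInt, signedDirac, JordanDecomposition.toJordanDecomposition_toSignedMeasure]
  simp [integral_dirac' f θ hf]

end SignedIntegral

lemma ZeroAtInftyContinuousMap.abs_apply_le_norm {X : Type*} [TopologicalSpace X]
    (g : C₀(X, ℝ)) (x : X) : |g x| ≤ ‖g‖ := by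
  rw [← ZeroAtInftyContinuousMap.norm_toBCF_eq_norm]
  exact g.toBCF.norm_coe_le_norm x

lemma ZeroAtInftyContinuousMap.coe_sum {X ι : Type*} [TopologicalSpace X] (s : Finset ι)
    (f : ι → C₀(X, ℝ)) : ⇑(∑ i ∈ s, f i) = ∑ i ∈ s, ⇑(f i) :=
  map_sum (AddMonoidHom.mk' (fun g : C₀(X, ℝ) => (g : X → ℝ)) fun _ _ => rfl) f s

lemma BNnorm_fMu_le_tvNorm (σ : ℝ → ℝ) (m : ℕ → ℕ) (D : ℕ) (ρ : Params m D → ℝ)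
    (μ : SignedMeasure (Params m D)) : BNnorm σ m D ρ (fMu σ m D ρ μ) ≤ tvNorm μ :=
  csInf_le ⟨0, by rintro _ ⟨ν, -, rfl⟩; exact tvNorm_nonneg ν⟩ ⟨μ, rfl, rfl⟩

lemma exists_tvNorm_lt_of_BNnorm_lt {σ : ℝ → ℝ} {m : ℕ → ℕ} {D : ℕ} {ρ : Params m D → ℝ}
    {μ : SignedMeasure (Params m D)} {c : ℝ} (h : BNnorm σ m D ρ (fMu σ m D ρ μ) < c) :
    ∃ ν, fMu σ m D ρ ν = fMu σ m D ρ μ ∧ tvNorm ν < c := by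
  have hne : {ν | fMu σ m D ρ ν = fMu σ m D ρ μ}.Nonempty := ⟨μ, rfl⟩
  obtain ⟨_, ⟨ν, hν, rfl⟩, hlt⟩ := exists_lt_of_csInf_lt (hne.image tvNorm) h
  exact ⟨ν, hν, hlt⟩

lemma sum_mul_fMu_eq_sInt {σ : ℝ → ℝ} {m : ℕ → ℕ} {D : ℕ} {ρ : Params m D → ℝ}
    {Kb : (Fin (m 0) → ℝ) → Fin (m D) → C₀(Params m D, ℝ)}
    (hKb : ∀ x k θ, Kb x k θ = NNet σ m D θ x k * ρ θ) {ι : Type*} [Fintype ι]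
    (α : ι → ℝ) (x : ι → (Fin (m 0) → ℝ)) (k : ι → Fin (m D)) (μ : SignedMeasure (Params m D)) :
    ∑ j, α j * fMu σ m D ρ μ (x j) (k j) = sInt μ ⇑(∑ j, α j • Kb (x j) (k j) : C₀(Params m D, ℝ)) := by
  simp only [fMu, ← hKb]
  rw [sum_mul_sInt]
  · congr 1
    ext θ
    rw [ZeroAtInftyContinuousMap.coe_sum]
    simp
  · intro ν _ j
    exact (Kb (x j) (k j)).toBCF.integrable ν

/-- For all coefficients `α_j`, points `x_j` and component indices
`k_j`, the dual norm of `∑_j α_j δ_{x_j, k_j}` on `B_N` equals the supremum norm of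
`∑_j α_j N_{k_j}(x_j, ·)ρ(·)` in `C₀(Θ)`; i.e. the map
`∑ α_j δ_{x_j,k_j} ↦ ∑ α_j N_{k_j}(x_j,·)ρ(·)` is an isometry. -/
theorem statement_6
    (σ : ℝ → ℝ) (hσ : Continuous σ) (m : ℕ → ℕ) (D : ℕ) (hD : 0 < D)
    (ρ : Params m D → ℝ) (hρc : Continuous ρ) (hρpos : ∀ θ, 0 < ρ θ)
    (Kb : (Fin (m 0) → ℝ) → Fin (m D) → C₀(Params m D, ℝ))
    (hKb : ∀ x k θ, Kb x k θ = NNet σ m D θ x k * ρ θ)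
    (M' : ℕ) (α : Fin M' → ℝ) (x : Fin M' → (Fin (m 0) → ℝ)) (k : Fin M' → Fin (m D)) :
    sSup {r : ℝ | ∃ μ : SignedMeasure (Params m D),
        BNnorm σ m D ρ (fMu σ m D ρ μ) ≤ 1 ∧
          r = |∑ j, α j * fMu σ m D ρ μ (x j) (k j)|}
      = ‖∑ j, α j • Kb (x j) (k j)‖ := by
  have hval := sum_mul_fMu_eq_sInt hKb α x k
  set g := ∑ j, α j • Kb (x j) (k j)
  have hle : ∀ r ∈ {r : ℝ | ∃ μ : SignedMeasure (Params m D),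
      BNnorm σ m D ρ (fMu σ m D ρ μ) ≤ 1 ∧
        r = |∑ j, α j * fMu σ m D ρ μ (x j) (k j)|}, r ≤ ‖g‖ := by
    rintro _ ⟨μ, hμ, rfl⟩
    have hlt (c : ℝ) (hc : 1 < c) : |∑ j, α j * fMu σ m D ρ μ (x j) (k j)| ≤ ‖g‖ * c := by
      obtain ⟨ν, hν, hνc⟩ := exists_tvNorm_lt_of_BNnorm_lt (hμ.trans_lt hc)
      rw [← hν, hval]
      exact (abs_sInt_le ν g.abs_apply_le_norm).trans
        (mul_le_mul_of_nonneg_left hνc.le (norm_nonneg g))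
    have hlim : Tendsto (fun c : ℝ => ‖g‖ * c) (𝓝[>] 1) (𝓝 ‖g‖) := by
      have := ((continuous_const_mul ‖g‖).tendsto 1).mono_left (nhdsWithin_le_nhds (s := Set.Ioi 1))
      simpa using this
    exact ge_of_tendsto hlim (eventually_nhdsWithin_of_forall hlt)
  have hmem (θ : Params m D) : |g θ| ∈ {r : ℝ | ∃ μ : SignedMeasure (Params m D),
      BNnorm σ m D ρ (fMu σ m D ρ μ) ≤ 1 ∧
        r = |∑ j, α j * fMu σ m D ρ μ (x j) (k j)|} := by
    refine ⟨signedDirac θ, (BNnorm_fMu_le_tvNorm ..).trans_eq (tvNorm_signedDirac θ), ?_⟩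
    rw [hval, sInt_signedDirac θ (map_continuous g).stronglyMeasurable]
  refine le_antisymm (csSup_le ⟨_, hmem 0⟩ hle) ?_
  rw [← ZeroAtInftyContinuousMap.norm_toBCF_eq_norm, BoundedContinuousFunction.norm_le_of_nonempty]
  exact fun θ => le_csSup ⟨_, hle⟩ (hmem θ)

end
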